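/- Let (W,S) be a Coxeter system and let A = W_{S_A} and B = W_{S_B} be special subgroups. Let w ∈ W, let d be the unique element of minimal length in the double coset AwB (the (S_A,S_B)-reduced element), and write w = a d b with a ∈ A and b ∈ B. Then A ∩ wBw⁻¹ = a ⟨S_A ∩ dS_Bd⁻¹⟩ a⁻¹. -/

import Mathlib

open CoxeterSystem

namespace CoxFA

variable {B : Type*}

/-- The special subgroup of `W` generated by the simple reflections indexed by `T`. -/
def sp {W : Type*} [Group W] {M : CoxeterMatrix B} (cs : CoxeterSystem M W) (T : Set B) :
    Subgroup W :=
  Subgroup.closure (cs.simple '' T)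

/-- The conjugate subgroup `w H w⁻¹`. -/
def conjSub {W : Type*} [Group W] (w : W) (H : Subgroup W) : Subgroup W :=
  H.map (MulAut.conj w).toMonoidHom

section Exchange

variable {W : Type*} [Group W] {M : CoxeterMatrix B} (cs : CoxeterSystem M W)

open Classical in
/-- The action of a simple reflection on signed group elements: it conjugates the element
and flips the sign of the reflection itself. -/
noncomputable def signedConj (i : B) : Function.End (W × ZMod 2) := fun p =>
  (cs.simple i * p.1 * cs.simple i, p.2 + if p.1 = cs.simple i then 1 else 0)

open Classical in
theorem signedConj_mul_pow_apply (i j : B) (n : ℕ) (t : W) (e : ZMod 2) :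
    ((signedConj cs i * signedConj cs j) ^ n : Function.End (W × ZMod 2)) (t, e) =
      ((cs.simple i * cs.simple j) ^ n * t * ((cs.simple i * cs.simple j) ^ n)⁻¹,
        e + ∑ k ∈ Finset.range (2 * n),
          if t = cs.simple j * (cs.simple i * cs.simple j) ^ k then 1 else 0) := by
  set r := cs.simple i * cs.simple j with hr
  have hinv : r⁻¹ = cs.simple j * cs.simple i := by simp [hr]
  have hcomm (k : ℕ) : (r ^ k)⁻¹ * cs.simple j = cs.simple j * r ^ k := by
    have hsemi : SemiconjBy (cs.simple j) r r⁻¹ := by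
      simp [SemiconjBy, hr, mul_assoc]
    simpa using (hsemi.pow_right k).eq.symm
  induction n with
  | zero => simp; rfl
  | succ n ih =>
    have hstep : ((signedConj cs i * signedConj cs j) ^ (n + 1) : Function.End (W × ZMod 2)) (t, e)
        = signedConj cs i (signedConj cs j
          (((signedConj cs i * signedConj cs j) ^ n : Function.End (W × ZMod 2)) (t, e))) := by
      rw [pow_succ']; rfl
    have h₁ : r ^ n * t * (r ^ n)⁻¹ = cs.simple j ↔ t = cs.simple j * r ^ (2 * n) := by
      rw [two_mul, pow_add, ← mul_assoc, ← hcomm, mul_inv_eq_iff_eq_mul,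
        ← eq_inv_mul_iff_mul_eq, mul_assoc]
    have h₂ : cs.simple j * (r ^ n * t * (r ^ n)⁻¹) * cs.simple j = cs.simple i ↔
        t = cs.simple j * r ^ (2 * n + 1) := by
      have : cs.simple j * r ^ (2 * n + 1) = (r ^ n)⁻¹ * (cs.simple j * r) * r ^ n := by
        rw [← mul_assoc, hcomm, mul_assoc, mul_assoc, ← pow_succ', ← pow_add]
        congr 2; ring
      rw [this, eq_mul_inv_iff_mul_eq.symm, cs.inv_simple, ← eq_inv_mul_iff_mul_eq,
        cs.inv_simple, mul_inv_eq_iff_eq_mul, ← eq_inv_mul_iff_mul_eq, ← mul_assoc]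
    rw [hstep, ih, show 2 * (n + 1) = 2 * n + 1 + 1 by ring, Finset.sum_range_succ,
      Finset.sum_range_succ]
    simp only [signedConj, h₁, h₂, Prod.mk.injEq]
    constructor
    · rw [pow_succ', mul_inv_rev, hinv, hr]; simp only [mul_assoc]
    · ring

theorem signedConj_isLiftable : M.IsLiftable (signedConj cs) := by
  classical
  intro i j
  funext ⟨t, e⟩
  rw [signedConj_mul_pow_apply, two_mul, Finset.sum_range_add]
  simp only [pow_add, cs.simple_mul_simple_pow, one_mul]
  rw [← two_mul, show (2 : ZMod 2) = 0 from rfl]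
  simp; rfl

/-- The action of a Coxeter group on signed group elements. -/
noncomputable def signedAction : W →* Function.End (W × ZMod 2) :=
  cs.lift ⟨signedConj cs, signedConj_isLiftable cs⟩

theorem signedAction_simple (i : B) : signedAction cs (cs.simple i) = signedConj cs i :=
  cs.lift_apply_simple _ i

open Classical in
theorem signedAction_wordProd (ω : List B) (t : W) (e : ZMod 2) :
    signedAction cs (cs.wordProd ω) (t, e) =
      (cs.wordProd ω * t * (cs.wordProd ω)⁻¹, e + ((cs.rightInvSeq ω).count t : ZMod 2)) := by
  induction ω with
  | nil => simp; rfl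
  | cons i ω ih =>
    have hstep : signedAction cs (cs.wordProd (i :: ω)) (t, e) =
        signedConj cs i (signedAction cs (cs.wordProd ω) (t, e)) := by
      rw [cs.wordProd_cons, map_mul, signedAction_simple]; rfl
    have h : cs.wordProd ω * t * (cs.wordProd ω)⁻¹ = cs.simple i ↔
        (cs.wordProd ω)⁻¹ * cs.simple i * cs.wordProd ω = t := by
      rw [mul_inv_eq_iff_eq_mul, ← eq_inv_mul_iff_mul_eq, ← mul_assoc, eq_comm]
    rw [hstep, ih]
    simp only [signedConj, h, CoxeterSystem.rightInvSeq, List.count_cons, beq_iff_eq,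
      Prod.mk.injEq]
    constructor
    · simp [cs.wordProd_cons, mul_assoc]
    · push_cast; ring

/-- The exchange condition. -/
theorem exists_eraseIdx_of_isRightDescent (ω : List B) (i : B)
    (h : cs.IsRightDescent (cs.wordProd ω) i) :
    ∃ j < ω.length, cs.wordProd ω * cs.simple i = cs.wordProd (ω.eraseIdx j) := by
  classical
  suffices hmem : cs.simple i ∈ cs.rightInvSeq ω by
    obtain ⟨j, hj, hji⟩ := List.mem_iff_getElem.mp hmem
    refine ⟨j, by simpa using hj, ?_⟩
    rw [← cs.wordProd_mul_getD_rightInvSeq, List.getD_eq_getElem _ _ hj, hji]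
  by_contra hmem
  obtain ⟨ω', hω', hprod⟩ := cs.exists_isReduced (cs.wordProd ω * cs.simple i)
  have key : (signedAction cs (cs.wordProd ω') (cs.simple i, 0)).2 = 1 := by
    rw [← hprod, map_mul, signedAction_simple]
    change (signedAction cs (cs.wordProd ω) (signedConj cs i (cs.simple i, 0))).2 = 1
    simp [signedConj, signedAction_wordProd, List.count_eq_zero_of_not_mem hmem]
  have hmem' : cs.simple i ∈ cs.rightInvSeq ω' := by
    by_contra hn
    simp [signedAction_wordProd, List.count_eq_zero_of_not_mem hn] at key
  have := (cs.isRightInversion_of_mem_rightInvSeq hω' hmem').2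
  rw [← hprod, cs.simple_mul_simple_cancel_right] at this
  exact absurd h (by unfold CoxeterSystem.IsRightDescent; omega)

end Exchange

section SpecialSubgroup

variable {W : Type*} [Group W] {M : CoxeterMatrix B} (cs : CoxeterSystem M W) {T U : Set B}

theorem simple_mem_sp {i : B} (hi : i ∈ T) : cs.simple i ∈ sp cs T :=
  Subgroup.subset_closure ⟨i, hi, rfl⟩

theorem wordProd_mem_sp {ω : List B} (h : ∀ i ∈ ω, i ∈ T) : cs.wordProd ω ∈ sp cs T := by
  induction ω with
  | nil => simp [one_mem]
  | cons i ω ih =>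
    rw [cs.wordProd_cons]
    exact mul_mem (simple_mem_sp cs (h i (by simp))) (ih fun k hk => h k (by simp [hk]))

theorem exists_isReduced_of_mem_sp {x : W} (hx : x ∈ sp cs T) :
    ∃ ω : List B, cs.IsReduced ω ∧ (∀ i ∈ ω, i ∈ T) ∧ x = cs.wordProd ω := by
  have step (x : W) (i : B) (hi : i ∈ T)
      (h : ∃ ω : List B, cs.IsReduced ω ∧ (∀ i ∈ ω, i ∈ T) ∧ x = cs.wordProd ω) :
      ∃ ω : List B, cs.IsReduced ω ∧ (∀ i ∈ ω, i ∈ T) ∧ x * cs.simple i = cs.wordProd ω := by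
    obtain ⟨ω, hω, hT, rfl⟩ := h
    by_cases hdesc : cs.IsRightDescent (cs.wordProd ω) i
    · obtain ⟨j, hj, hprod⟩ := exists_eraseIdx_of_isRightDescent cs ω i hdesc
      refine ⟨ω.eraseIdx j, ?_, fun k hk => hT k (List.mem_of_mem_eraseIdx hk), hprod⟩
      have h₁ := cs.isRightDescent_iff.mp hdesc
      have h₂ := hω.eq
      rw [CoxeterSystem.IsReduced, ← hprod, List.length_eraseIdx_of_lt hj]
      omega
    · refine ⟨ω ++ [i], ?_, ?_, ?_⟩
      · have h₁ := cs.not_isRightDescent_iff.mp hdesc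
        rw [CoxeterSystem.IsReduced, cs.wordProd_append, cs.wordProd_singleton, h₁, hω.eq]
        simp
      · simp only [List.mem_append, List.mem_singleton]
        rintro k (hk | rfl)
        exacts [hT k hk, hi]
      · simp [cs.wordProd_append]
  induction hx using Subgroup.closure_induction_right with
  | one => exact ⟨[], by simp [CoxeterSystem.IsReduced], by simp, by simp⟩
  | mul_right x hx y hy ih =>
    obtain ⟨i, hi, rfl⟩ := hy
    exact step x i hi ih
  | mul_inv_cancel x hx y hy ih =>
    obtain ⟨i, hi, rfl⟩ := hy
    rw [cs.inv_simple]
    exact step x i hi ih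

theorem mem_image_simple_of_length_eq_one {x : W} (hx : x ∈ sp cs T) (h : cs.length x = 1) :
    x ∈ cs.simple '' T := by
  obtain ⟨ω, hω, hT, rfl⟩ := exists_isReduced_of_mem_sp cs hx
  obtain ⟨i, rfl⟩ := List.length_eq_one_iff.mp (hω.eq.symm.trans h)
  exact ⟨i, hT i (by simp), by simp⟩

/-- Lengths add when an element that is minimal in its left coset of a special subgroup is
multiplied by an element of that subgroup. -/
theorem length_mul_of_forall_length_le {d y : W}
    (hd : ∀ z ∈ sp cs T, cs.length d ≤ cs.length (d * z)) (hy : y ∈ sp cs T) :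
    cs.length (d * y) = cs.length d + cs.length y := by
  obtain ⟨ω, hω, hT, rfl⟩ := exists_isReduced_of_mem_sp cs hy
  clear hy
  rw [hω.eq]
  induction ω using List.reverseRecOn with
  | nil => simp
  | append_singleton ω i ih =>
    have hω' : cs.IsReduced ω := by simpa using hω.take ω.length
    have hT' : ∀ k ∈ ω, k ∈ T := fun k hk => hT k (by simp [hk])
    have hi : i ∈ T := hT i (by simp)
    have ih := ih hω' hT'
    rw [cs.wordProd_append, cs.wordProd_singleton, ← mul_assoc, List.length_append,
      List.length_singleton, ← add_assoc, ← ih]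
    refine cs.not_isRightDescent_iff.mp fun hdesc => ?_
    obtain ⟨δ, hδ, rfl⟩ := cs.exists_isReduced d
    rw [← cs.wordProd_append] at hdesc
    obtain ⟨j, hj, hprod⟩ := exists_eraseIdx_of_isRightDescent cs _ i hdesc
    rcases lt_or_ge j δ.length with hlt | hge
    · rw [List.eraseIdx_append_of_lt_length hlt, cs.wordProd_append, cs.wordProd_append] at hprod
      have hmem := wordProd_mem_sp cs hT'
      have hle := hd _ (mul_mem (mul_mem hmem (simple_mem_sp cs hi)) (inv_mem hmem))
      rw [show cs.wordProd δ * (cs.wordProd ω * cs.simple i * (cs.wordProd ω)⁻¹) =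
        cs.wordProd (δ.eraseIdx j) by
          rw [← mul_assoc, ← mul_assoc, hprod, mul_inv_cancel_right], hδ.eq] at hle
      have := cs.length_wordProd_le (δ.eraseIdx j)
      rw [List.length_eraseIdx_of_lt hlt] at this
      omega
    · rw [List.eraseIdx_append_of_length_le hge, cs.wordProd_append, cs.wordProd_append,
        mul_assoc, mul_left_cancel_iff] at hprod
      rw [List.length_append] at hj
      have hred := hω.eq
      rw [cs.wordProd_append, cs.wordProd_singleton, hprod] at hred
      have := cs.length_wordProd_le (ω.eraseIdx (j - δ.length))
      rw [List.length_eraseIdx_of_lt (by omega)] at this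
      simp at hred
      omega

theorem length_mul_of_forall_length_le' {d x : W}
    (hd : ∀ z ∈ sp cs T, cs.length d ≤ cs.length (z * d)) (hx : x ∈ sp cs T) :
    cs.length (x * d) = cs.length x + cs.length d := by
  have := length_mul_of_forall_length_le cs (d := d⁻¹) (y := x⁻¹) (T := T)
    (fun z hz => by simpa [← cs.length_inv (d⁻¹ * z)] using hd _ (inv_mem hz)) (inv_mem hx)
  rwa [← mul_inv_rev, cs.length_inv, cs.length_inv, cs.length_inv, add_comm] at this

theorem mem_closure_of_mul_eq_mul {d : W}
    (hd : ∀ x ∈ sp cs T, ∀ y ∈ sp cs U, cs.length d ≤ cs.length (x * d * y))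
    {x y : W} (hx : x ∈ sp cs T) (hy : y ∈ sp cs U) (hxy : x * d = d * y) :
    x ∈ Subgroup.closure
      (cs.simple '' T ∩ (fun z => d * z * d⁻¹) '' (cs.simple '' U)) := by
  have hdl : ∀ z ∈ sp cs T, cs.length d ≤ cs.length (z * d) := fun z hz => by
    simpa using hd z hz 1 (one_mem _)
  have hdr : ∀ z ∈ sp cs U, cs.length d ≤ cs.length (d * z) := fun z hz => by
    simpa using hd 1 (one_mem _) z hz
  obtain ⟨ω, hω, hU, rfl⟩ := exists_isReduced_of_mem_sp cs hy
  clear hy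
  induction ω using List.reverseRecOn generalizing x with
  | nil =>
    obtain rfl : x = 1 := by simpa using hxy
    exact one_mem _
  | append_singleton ω i ih =>
    have hω' : cs.IsReduced ω := by simpa using hω.take ω.length
    have hU' : ∀ k ∈ ω, k ∈ U := fun k hk => hU k (by simp [hk])
    have hi : i ∈ U := hU i (by simp)
    have hxyi : x * d * cs.simple i = d * cs.wordProd ω := by
      rw [hxy, cs.wordProd_append]
      simp [mul_assoc]
    have hdesc : cs.IsRightDescent (x * d) i := by
      rw [CoxeterSystem.IsRightDescent, hxyi, hxy,
        length_mul_of_forall_length_le cs hdr (wordProd_mem_sp cs hU'),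
        length_mul_of_forall_length_le cs hdr (wordProd_mem_sp cs hU), hω.eq, hω'.eq]
      simp
    obtain ⟨ξ, hξ, hT, rfl⟩ := exists_isReduced_of_mem_sp cs hx
    obtain ⟨δ, hδ, hdδ⟩ := cs.exists_isReduced d
    have hdi : cs.length (d * cs.simple i) = cs.length d + 1 := by
      rw [length_mul_of_forall_length_le cs hdr (simple_mem_sp cs hi), cs.length_simple]
    have hmem : d * cs.simple i * d⁻¹ ∈ sp cs T := by
      rw [hdδ, ← cs.wordProd_append] at hdesc
      obtain ⟨j, hj, hprod⟩ := exists_eraseIdx_of_isRightDescent cs _ i hdesc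
      rcases lt_or_ge j ξ.length with hlt | hge
      · rw [List.eraseIdx_append_of_lt_length hlt, cs.wordProd_append, cs.wordProd_append,
          ← hdδ] at hprod
        have hξ' : cs.wordProd (ξ.eraseIdx j) ∈ sp cs T :=
          wordProd_mem_sp cs fun k hk => hT k (List.mem_of_mem_eraseIdx hk)
        convert mul_mem (inv_mem hx) hξ' using 1
        rw [mul_inv_eq_iff_eq_mul, mul_assoc, ← hprod]
        simp [mul_assoc]
      · rw [List.eraseIdx_append_of_length_le hge, cs.wordProd_append, cs.wordProd_append,
          mul_assoc, mul_left_cancel_iff, ← hdδ] at hprod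
        rw [List.length_append] at hj
        have := cs.length_wordProd_le (δ.eraseIdx (j - ξ.length))
        rw [← hprod, hdi, List.length_eraseIdx_of_lt (by omega), hdδ, hδ.eq] at this
        omega
    have hlen : cs.length (d * cs.simple i * d⁻¹) = 1 := by
      have := length_mul_of_forall_length_le' cs hdl hmem
      rw [inv_mul_cancel_right, hdi] at this
      omega
    have hgen : d * cs.simple i * d⁻¹ ∈ Subgroup.closure
        (cs.simple '' T ∩ (fun z => d * z * d⁻¹) '' (cs.simple '' U)) :=
      Subgroup.subset_closure
        ⟨mem_image_simple_of_length_eq_one cs hmem hlen, cs.simple i, ⟨i, hi, rfl⟩, rfl⟩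
    refine (Subgroup.mul_mem_cancel_right _ hgen).mp (ih (mul_mem hx hmem) hω' hU' ?_)
    rw [← hxyi]
    simp [mul_assoc]

theorem closure_le_sp (d : W) :
    Subgroup.closure (cs.simple '' T ∩ (fun z => d * z * d⁻¹) '' (cs.simple '' U)) ≤
      sp cs T ⊓ conjSub d (sp cs U) := by
  rw [Subgroup.closure_le]
  rintro _ ⟨hT, z, hz, rfl⟩
  exact ⟨Subgroup.subset_closure hT, z, Subgroup.subset_closure hz, rfl⟩

end SpecialSubgroup

/-- Kilmoyer. If `d` is the unique minimal-length element of the double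
coset `A w B` and `w = a d b` with `a ∈ A`, `b ∈ B`, then
`A ∩ w B w⁻¹ = a ⟨S_A ∩ d S_B d⁻¹⟩ a⁻¹`. -/
theorem stmt_2 {W : Type*} [Group W] [Fintype B] {M : CoxeterMatrix B}
    (cs : CoxeterSystem M W) (SA SB : Set B) (w d a b : W)
    (hd : ∃ x ∈ sp cs SA, ∃ y ∈ sp cs SB, d = x * w * y)
    (hdmin : ∀ u : W, (∃ x ∈ sp cs SA, ∃ y ∈ sp cs SB, u = x * w * y) →
      cs.length d ≤ cs.length u)
    (ha : a ∈ sp cs SA) (hb : b ∈ sp cs SB) (hw : w = a * d * b) :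
    sp cs SA ⊓ conjSub w (sp cs SB) =
      conjSub a (Subgroup.closure
        (cs.simple '' SA ∩ (fun x => d * x * d⁻¹) '' (cs.simple '' SB))) := by
  have hmin : ∀ x ∈ sp cs SA, ∀ y ∈ sp cs SB, cs.length d ≤ cs.length (x * d * y) := by
    intro x hx y hy
    refine hdmin _ ⟨x * a⁻¹, mul_mem hx (inv_mem ha), b⁻¹ * y, mul_mem (inv_mem hb) hy, ?_⟩
    rw [hw]
    group
  ext g
  constructor
  · rintro ⟨hg, y, hy, rfl⟩
    refine ⟨a⁻¹ * (w * y * w⁻¹) * a, ?_, by simp [MulAut.conj_apply, mul_assoc]⟩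
    refine mem_closure_of_mul_eq_mul cs hmin (mul_mem (mul_mem (inv_mem ha) hg) ha)
      (mul_mem (mul_mem hb hy) (inv_mem hb)) ?_
    rw [hw]
    group
  · rintro ⟨k, hk, rfl⟩
    obtain ⟨hkA, y, hy, rfl⟩ := closure_le_sp cs d hk
    refine ⟨(sp cs SA).mul_mem ((sp cs SA).mul_mem ha hkA) ((sp cs SA).inv_mem ha),
      b⁻¹ * y * b, mul_mem (mul_mem (inv_mem hb) hy) hb, ?_⟩
    simp [MulAut.conj_apply, hw, mul_assoc]

end CoxFA
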